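/- Let G be a finite group with |G| ≥ 3. Then max Δ*(G) = |G| − 2 if and only if G is cyclic or G is a dihedral group of order 2n for some odd n ≥ 3. -/

import Mathlib

namespace ProductOne

open scoped Classical

variable {G : Type*} [Group G]

/-- `S` is a product-one sequence over `G`: its terms can be ordered with product `1`. -/
def IsProductOne (S : Multiset G) : Prop :=
  ∃ l : List G, (l : Multiset G) = S ∧ l.prod = 1

/-- `S` is an atom (a minimal product-one sequence): it is a nontrivial product-one
sequence that is not the concatenation of two nontrivial product-one sequences. -/
def IsAtomSeq (S : Multiset G) : Prop :=
  S ≠ 0 ∧ IsProductOne S ∧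
    ∀ A B : Multiset G, S = A + B → IsProductOne A → IsProductOne B → A = 0 ∨ B = 0

/-- `S` is a sequence over the subset `G₀ ⊆ G`. -/
def SeqOn (G₀ : Set G) (S : Multiset G) : Prop := ∀ g ∈ S, g ∈ G₀

/-- `S` is an atom of the monoid `B(G₀)` of product-one sequences over `G₀`. -/
def IsAtomSeqOn (G₀ : Set G) (S : Multiset G) : Prop := SeqOn G₀ S ∧ IsAtomSeq S

/-- The set of lengths `L(A)` of factorizations of `A` into atoms over `G₀`. -/
def lengthsOn (G₀ : Set G) (A : Multiset G) : Set ℕ :=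
  {k | ∃ f : Multiset (Multiset G), Multiset.card f = k ∧
        (∀ U ∈ f, IsAtomSeqOn G₀ U) ∧ f.sum = A}

/-- The set of lengths `L(A)` over the whole group. -/
def lengths (A : Multiset G) : Set ℕ := lengthsOn Set.univ A

/-- The set of distances of a set `L ⊆ ℕ`. -/
def distancesOf (L : Set ℕ) : Set ℕ :=
  {d | 0 < d ∧ ∃ a, a ∈ L ∧ a + d ∈ L ∧ ∀ b ∈ L, ¬(a < b ∧ b < a + d)}

/-- The set of distances `Δ(G₀)` of the monoid `B(G₀)`. -/
def DeltaOn (G₀ : Set G) : Set ℕ :=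
  {d | ∃ A : Multiset G, SeqOn G₀ A ∧ IsProductOne A ∧ d ∈ distancesOf (lengthsOn G₀ A)}

/-- The set of distances `Δ(G)` of `B(G)`. -/
def Delta (G : Type*) [Group G] : Set ℕ := DeltaOn (Set.univ : Set G)

/-- The large Davenport constant of `G₀`: maximal length of an atom of `B(G₀)`. -/
noncomputable def DavenportOn (G₀ : Set G) : ℕ :=
  sSup {k | ∃ S : Multiset G, IsAtomSeqOn G₀ S ∧ Multiset.card S = k}

/-- The large Davenport constant `D(G)`. -/
noncomputable def Davenport (G : Type*) [Group G] : ℕ :=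
  DavenportOn (Set.univ : Set G)

/-- The small Davenport constant `d(G₀)`: maximal length of a product-one free
sequence over `G₀`. -/
noncomputable def smallDavenportOn (G₀ : Set G) : ℕ :=
  sSup {k | ∃ S : Multiset G, SeqOn G₀ S ∧ Multiset.card S = k ∧
        ∀ T : Multiset G, T ≤ S → T ≠ 0 → ¬IsProductOne T}

/-- `Δ*(G) = {min Δ(G₀) : G₀ ⊆ G with Δ(G₀) ≠ ∅}`. -/
def DeltaStar (G : Type*) [Group G] : Set ℕ :=
  {d | ∃ G₀ : Set G, (DeltaOn G₀).Nonempty ∧ d = sInf (DeltaOn G₀)}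

/-- The elasticity `ρ(L) = max L / min L` of a set of lengths (with the set of
positive elements used, and `ρ = 1` if there are none). -/
noncomputable def elasticity (L : Set ℕ) : ℚ :=
  if (L ∩ {k | 0 < k}).Nonempty then
    ((sSup (L ∩ {k | 0 < k}) : ℕ) : ℚ) / ((sInf (L ∩ {k | 0 < k}) : ℕ) : ℚ)
  else 1

/-- The elasticity `ρ(G₀)` of the monoid `B(G₀)`. -/
noncomputable def rhoOn (G₀ : Set G) : ℝ :=
  sSup {x : ℝ | ∃ A : Multiset G, SeqOn G₀ A ∧ IsProductOne A ∧
    x = (elasticity (lengthsOn G₀ A) : ℝ)}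

/-- `Δ*_ρ(G) = {min Δ(G₀) : G₀ ⊆ G with ρ(G₀) = D(G)/2}`. -/
noncomputable def DeltaRhoStar (G : Type*) [Group G] : Set ℕ :=
  {d | ∃ G₀ : Set G, rhoOn G₀ = (Davenport G : ℝ) / 2 ∧ d = sInf (DeltaOn G₀)}

/-- Divisibility in the monoid `B(G)`. -/
def BDvd (A S : Multiset G) : Prop :=
  ∃ C : Multiset G, IsProductOne C ∧ S = A + C

/-- The `ω`-invariant `ω(B(G), A)`. -/
noncomputable def omegaAt (A : Multiset G) : ℕ∞ :=
  sInf {N : ℕ∞ | ∀ f : Multiset (Multiset G),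
    (∀ B ∈ f, IsProductOne B) → BDvd A f.sum →
    ∃ t ≤ f, (Multiset.card t : ℕ∞) ≤ N ∧ BDvd A t.sum}

/-- `ω(G) = sup {ω(B(G), U) : U an atom of B(G)}`. -/
noncomputable def omegaInv (G : Type*) [Group G] : ℕ∞ :=
  ⨆ U ∈ {U : Multiset G | IsAtomSeq U}, omegaAt U

/-- `z` is a factorization of `A` into atoms. -/
def IsFactorization (A : Multiset G) (z : Multiset (Multiset G)) : Prop :=
  (∀ U ∈ z, IsAtomSeq U) ∧ z.sum = A

/-- The distance between two factorizations. -/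
noncomputable def factDist (z z' : Multiset (Multiset G)) : ℕ :=
  letI := Classical.decEq (Multiset G)
  max (Multiset.card (z - z')) (Multiset.card (z' - z))

/-- The catenary degree `c(A)`. -/
noncomputable def catenaryAt (A : Multiset G) : ℕ∞ :=
  sInf {N : ℕ∞ | ∀ z z' : Multiset (Multiset G),
    IsFactorization A z → IsFactorization A z' →
    Relation.ReflTransGen
      (fun x y => IsFactorization A y ∧ (factDist x y : ℕ∞) ≤ N) z z'}

/-- The set of positive catenary degrees `Ca(G)`. -/
noncomputable def CatenarySet (G : Type*) [Group G] : Set ℕ∞ :=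
  {c | ∃ A : Multiset G, IsProductOne A ∧ catenaryAt A = c ∧ 0 < c}

/-- The catenary degree `c(G)` of `B(G)`. -/
noncomputable def catenaryDegree (G : Type*) [Group G] : ℕ∞ :=
  ⨆ A ∈ {A : Multiset G | IsProductOne A}, catenaryAt A

/-- The cross number `k(S)` of a sequence. -/
noncomputable def crossNumber (S : Multiset G) : ℚ :=
  (S.map fun g => (1 : ℚ) / (orderOf g : ℚ)).sum

/-- The system of sets of lengths `L(G)`. -/
def LSystem (G : Type*) [Group G] : Set (Set ℕ) :=
  {L | ∃ A : Multiset G, IsProductOne A ∧ L = lengths A}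

/-- The set of products `π(S)` of all orderings of the terms of `S`. -/
def piSet (S : Multiset G) : Set G :=
  {g | ∃ l : List G, (l : Multiset G) = S ∧ l.prod = g}

/-- The sumset `{x₁, -x₁} + ⋯ + {x_s, -x_s}` for a sequence `a = x₁ ⋯ x_s`. -/
def signedSums {α : Type*} [AddCommGroup α] (a : Multiset α) : Set α :=
  {z | ∃ t ≤ a, z = t.sum + t.sum - a.sum}

/-- `Σ_k(T)`: the set of sums of `k`-term subsequences of `T`. -/
def subseqSums {α : Type*} [AddCommMonoid α] (k : ℕ) (T : Multiset α) : Set α :=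
  {z | ∃ t ≤ T, Multiset.card t = k ∧ t.sum = z}

/-- The subsequence `S_X` of all terms of `S` lying in `X`. -/
noncomputable def restrictTo (X : Set G) (S : Multiset G) : Multiset G :=
  letI := Classical.decPred fun g => g ∈ X
  S.filter fun g => g ∈ X

/-- The maximum multiplicity `h(S)` of a term of `S`. -/
noncomputable def maxMultiplicity {α : Type*} (S : Multiset α) : ℕ :=
  letI := Classical.decEq α
  S.toFinset.sup S.count

end ProductOne

namespace ProductOne

open scoped Classical

section Basic

/-- If the total multiplicities are large enough, the terms of a list lie in distinct members of
a family of short multisets. -/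
theorem exists_distinct_containing {α : Type*} {D : ℕ} {l : List α} :
    ∀ {f : Multiset (Multiset α)}, (∀ V ∈ f, Multiset.card V ≤ D) →
      (∀ g ∈ l, D * l.length < f.sum.count g) →
      ∃ vs : List (Multiset α), (vs : Multiset (Multiset α)) ≤ f ∧
        List.Forall₂ (fun g V => g ∈ V) l vs := by
  induction l with
  | nil => exact fun _ _ => ⟨[], by simp, List.Forall₂.nil⟩
  | cons g l ih =>
    intro f hf hc
    have hg : g ∈ f.sum := Multiset.count_pos.mp (by have := hc g (by simp); omega)
    obtain ⟨V, hV, hgV⟩ : ∃ V ∈ f, g ∈ V := Multiset.mem_join.mp hg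
    obtain ⟨f', rfl⟩ := Multiset.exists_cons_of_mem hV
    obtain ⟨vs, hle, hvs⟩ := ih (f := f') (fun W hW => hf W (by simp [hW])) fun h hh => by
      have h1 := hc h (by simp [hh])
      have h2 := (V.count_le_card h).trans (hf V hV)
      rw [Multiset.sum_cons, Multiset.count_add, List.length_cons, Nat.mul_succ] at h1
      omega
    exact ⟨V :: vs, by rw [← Multiset.cons_coe]; exact (Multiset.cons_le_cons_iff V).mpr hle,
      List.Forall₂.cons hgV hvs⟩

variable {G : Type*} [Group G] {G₀ : Set G} {A B U V : Multiset G}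

theorem isProductOne_zero : IsProductOne (0 : Multiset G) := ⟨[], rfl, rfl⟩

theorem IsProductOne.add (hA : IsProductOne A) (hB : IsProductOne B) : IsProductOne (A + B) := by
  obtain ⟨k, rfl, hk⟩ := hA
  obtain ⟨l, rfl, hl⟩ := hB
  exact ⟨k ++ l, (Multiset.coe_add k l).symm, by simp [hk, hl]⟩

theorem isProductOne_sum {f : Multiset (Multiset G)} (hf : ∀ U ∈ f, IsProductOne U) :
    IsProductOne f.sum := by
  induction f using Multiset.induction with
  | empty => exact isProductOne_zero
  | cons U f ih =>
    rw [Multiset.sum_cons]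
    exact (hf U (by simp)).add (ih fun V hV => hf V (by simp [hV]))

theorem isProductOne_replicate {g : G} {k : ℕ} (h : g ^ k = 1) :
    IsProductOne (Multiset.replicate k g) :=
  ⟨List.replicate k g, Multiset.coe_replicate k g, by simpa using h⟩

theorem isProductOne_pair {g h : G} (hgh : g * h = 1) : IsProductOne ({g, h} : Multiset G) :=
  ⟨[g, h], rfl, by simpa using hgh⟩

theorem IsAtomSeq.eq_of_le (hU : IsAtomSeq U) (hA : IsProductOne A) (hB : IsProductOne B)
    (h : U = A + B) (hA0 : A ≠ 0) : U = A := by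
  rcases hU.2.2 A B h hA hB with h0 | h0
  · exact absurd h0 hA0
  · simpa [h0] using h

theorem IsAtomSeq.eq_singleton_one (hU : IsAtomSeq U) (h1 : (1 : G) ∈ U) : U = {1} := by
  obtain ⟨l, rfl, hl⟩ := hU.2.1
  obtain ⟨s, t, rfl⟩ := List.append_of_mem (Multiset.mem_coe.mp h1)
  refine hU.eq_of_le (A := {1}) (B := ((s ++ t : List G) : Multiset G)) ⟨[1], rfl, by simp⟩
    ⟨s ++ t, rfl, by simpa using hl⟩ ?_ (by simp)
  simp only [← Multiset.coe_add, ← Multiset.cons_coe, Multiset.singleton_add]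
  simp

/-- A product-one sequence has a factorization into atoms. -/
theorem exists_factorization (hS : SeqOn G₀ A) (hA : IsProductOne A) :
    ∃ f : Multiset (Multiset G), (∀ U ∈ f, IsAtomSeqOn G₀ U) ∧ f.sum = A := by
  induction hn : Multiset.card A using Nat.strong_induction_on generalizing A with
  | _ n ih =>
    by_cases h0 : A = 0
    · exact ⟨0, by simp, by simp [h0]⟩
    by_cases hat : IsAtomSeq A
    · exact ⟨{A}, by simpa using ⟨hS, hat⟩, by simp⟩
    simp only [IsAtomSeq, not_and, not_forall] at hat
    obtain ⟨B, C, rfl, hB, hC, h⟩ := hat h0 hA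
    push Not at h
    have hB0 := Multiset.card_pos.mpr h.1
    have hC0 := Multiset.card_pos.mpr h.2
    rw [Multiset.card_add] at hn
    obtain ⟨f, hf, rfl⟩ := ih _ (by omega) (fun g hg => hS g (by simp [hg])) hB rfl
    obtain ⟨f', hf', rfl⟩ := ih _ (by omega) (fun g hg => hS g (by simp [hg])) hC rfl
    refine ⟨f + f', fun U hU => ?_, by simp⟩
    rcases Multiset.mem_add.mp hU with h | h
    exacts [hf U h, hf' U h]

theorem exists_list_prod_eq_inv {g : G} (hV : IsProductOne V) (hg : g ∈ V) :
    ∃ l : List G, V = g ::ₘ (l : Multiset G) ∧ l.prod = g⁻¹ := by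
  obtain ⟨l, rfl, hl⟩ := hV
  obtain ⟨s, t, rfl⟩ := List.append_of_mem (Multiset.mem_coe.mp hg)
  refine ⟨t ++ s, ?_, ?_⟩
  · rw [Multiset.cons_coe, Multiset.coe_eq_coe]
    exact List.perm_middle.trans (List.Perm.cons g List.perm_append_comm)
  · simp only [List.prod_append, List.prod_cons] at hl ⊢
    rw [← mul_assoc, mul_eq_one_iff_inv_eq] at hl
    rw [← hl]
    group

/-- Distinct terms of a sequence may be removed from distinct product-one sequences, and what
remains can be ordered to have the inverse product. -/
theorem exists_complement {l : List G} {vs : List (Multiset G)}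
    (h : List.Forall₂ (fun g V => g ∈ V) l vs) (hvs : ∀ V ∈ vs, IsProductOne V) :
    ∃ w : List G, vs.sum = (l : Multiset G) + (w : Multiset G) ∧ w.prod = l.prod⁻¹ := by
  induction h with
  | nil => exact ⟨[], by simp, by simp⟩
  | @cons g V l vs hg _ ih =>
    obtain ⟨w, hw, hwp⟩ := ih fun W hW => hvs W (by simp [hW])
    obtain ⟨s, rfl, hs⟩ := exists_list_prod_eq_inv (hvs V (by simp)) hg
    refine ⟨w ++ s, ?_, by simp [hwp, hs]⟩
    rw [List.sum_cons, hw, ← Multiset.cons_coe, ← Multiset.coe_add, Multiset.cons_add,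
      Multiset.cons_add]
    congr 1
    abel

/-- The partial products of an ordering of an atom with product one are pairwise distinct. -/
theorem IsAtomSeq.take_prod_injOn {l : List G} (hU : IsAtomSeq (l : Multiset G))
    (hl : l.prod = 1) {i j : ℕ} (hij : i < j) (hj : j < l.length) :
    (l.take i).prod ≠ (l.take j).prod := by
  intro h
  have hsplit : l.take j = l.take i ++ (l.take j).drop i := by
    conv_lhs => rw [← List.take_append_drop i (l.take j), List.take_take, min_eq_left hij.le]
  have hm : ((l.take j).drop i).prod = 1 := by
    rw [hsplit, List.prod_append] at h
    simpa using h
  have hr : (l.take i ++ l.drop j).prod = 1 := by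
    rw [List.prod_append, h, ← List.prod_append, List.take_append_drop, hl]
  have heq : (l : Multiset G) =
      (((l.take j).drop i : List G) : Multiset G) +
        ((l.take i ++ l.drop j : List G) : Multiset G) := by
    conv_lhs => rw [← List.take_append_drop j l, hsplit]
    simp only [← Multiset.coe_add]
    abel
  rcases hU.2.2 _ _ heq ⟨_, rfl, hm⟩ ⟨_, rfl, hr⟩ with h0 | h0
  · have := congrArg Multiset.card h0
    simp at this
    omega
  · have := congrArg Multiset.card h0
    simp at this
    omega

theorem IsAtomSeq.take_prod_injective {l : List G} (hU : IsAtomSeq (l : Multiset G))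
    (hl : l.prod = 1) : Function.Injective fun i : Fin l.length => (l.take i).prod := by
  intro i j h
  rcases lt_trichotomy i j with hlt | heq | hlt
  · exact absurd h (hU.take_prod_injOn hl hlt j.2)
  · exact heq
  · exact absurd h.symm (hU.take_prod_injOn hl hlt i.2)

theorem IsAtomSeq.card_le [Finite G] (hU : IsAtomSeq U) : Multiset.card U ≤ Nat.card G := by
  obtain ⟨l, rfl, hl⟩ := hU.2.1
  simpa using Nat.card_le_card_of_injective _ (hU.take_prod_injective hl)

theorem isAtomSeq_pair {g : G} (hg : g ≠ 1) : IsAtomSeq ({g, g⁻¹} : Multiset G) := by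
  refine ⟨by simp, isProductOne_pair (by simp), fun A B hAB hA hB => ?_⟩
  have key : ∀ {C : Multiset G}, IsProductOne C → C ≤ {g, g⁻¹} → Multiset.card C ≠ 1 := by
    intro C hC hle h1
    obtain ⟨x, rfl⟩ := Multiset.card_eq_one.mp h1
    obtain ⟨l, hl, hp⟩ := hC
    rw [Multiset.coe_eq_singleton] at hl
    subst hl
    have hx : x ∈ ({g, g⁻¹} : Multiset G) := Multiset.singleton_le.mp hle
    simp at hp hx
    subst hp
    rcases hx with h | h
    · exact hg h.symm
    · exact hg (by simpa using h.symm)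
  have hc := congrArg Multiset.card hAB
  simp only [Multiset.insert_eq_cons, Multiset.card_cons, Multiset.card_singleton,
    Multiset.card_add] at hc
  have h1 := key hA (hAB ▸ Multiset.le_add_right A B)
  have h2 := key hB (hAB ▸ Multiset.le_add_left B A)
  rw [← Multiset.card_eq_zero, ← Multiset.card_eq_zero (s := B)]
  omega

theorem isAtomSeq_replicate_orderOf [Finite G] (g : G) :
    IsAtomSeq (Multiset.replicate (orderOf g) g) := by
  have hpos := orderOf_pos g
  refine ⟨fun h => ?_, isProductOne_replicate (pow_orderOf_eq_one g), fun A B hAB hA hB => ?_⟩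
  · have := congrArg Multiset.card h
    rw [Multiset.card_replicate, Multiset.card_zero] at this
    omega
  have key : ∀ {C : Multiset G}, IsProductOne C → C ≤ Multiset.replicate (orderOf g) g →
      orderOf g ∣ Multiset.card C := by
    rintro _ ⟨l, rfl, hl⟩ hle
    obtain ⟨k, -, hk⟩ := Multiset.le_replicate_iff.mp hle
    rw [← Multiset.coe_replicate, Multiset.coe_eq_coe, List.perm_replicate] at hk
    subst hk
    simpa [orderOf_dvd_iff_pow_eq_one] using hl
  have hc := congrArg Multiset.card hAB
  rw [Multiset.card_replicate, Multiset.card_add] at hc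
  obtain ⟨x, hx⟩ := key hA (hAB ▸ Multiset.le_add_right A B)
  rw [← Multiset.card_eq_zero, ← Multiset.card_eq_zero (s := B)]
  rcases Nat.eq_zero_or_pos x with rfl | hx0
  · left; simpa using hx
  · right
    have := Nat.le_mul_of_pos_right (orderOf g) hx0
    omega

end Basic

section MultisetSums

variable {α : Type*}

theorem card_sum_le {D : ℕ} {f : Multiset (Multiset α)} (hf : ∀ V ∈ f, Multiset.card V ≤ D) :
    Multiset.card f.sum ≤ Multiset.card f * D := by
  induction f using Multiset.induction with
  | empty => simp
  | cons V f ih =>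
    have h1 := hf V (by simp)
    have h2 := ih fun W hW => hf W (by simp [hW])
    rw [Multiset.sum_cons, Multiset.card_add, Multiset.card_cons, Nat.succ_mul]
    omega

theorem mul_card_le_card_sum {D : ℕ} {f : Multiset (Multiset α)}
    (hf : ∀ V ∈ f, D ≤ Multiset.card V) :
    Multiset.card f * D ≤ Multiset.card f.sum := by
  induction f using Multiset.induction with
  | empty => simp
  | cons V f ih =>
    have h1 := hf V (by simp)
    have h2 := ih fun W hW => hf W (by simp [hW])
    rw [Multiset.sum_cons, Multiset.card_add, Multiset.card_cons, Nat.succ_mul]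
    omega

theorem count_le_count_sum {u : Multiset (Multiset α)} {g : α} {U : Multiset α} (hg : g ∈ U) :
    u.count U ≤ u.sum.count g := by
  obtain ⟨w, hw⟩ := Multiset.le_iff_exists_add.mp
    (Multiset.le_count_iff_replicate_le.mp (le_refl (u.count U)))
  have h1 : 1 ≤ U.count g := Multiset.one_le_count_iff_mem.mpr hg
  have h2 : u.sum.count g = u.count U * U.count g + w.sum.count g := by
    conv_lhs => rw [hw]
    simp [Multiset.sum_replicate, Multiset.count_nsmul]
  rw [h2]
  nlinarith

end MultisetSums

section Gaps

variable {G : Type*} [Group G] {G₀ : Set G} {A B U V : Multiset G}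

theorem IsAtomSeqOn.isProductOne_sum {f : Multiset (Multiset G)}
    (hf : ∀ U ∈ f, IsAtomSeqOn G₀ U) : IsProductOne f.sum :=
  ProductOne.isProductOne_sum fun U hU => (hf U hU).2.2.1

theorem IsAtomSeqOn.seqOn_sum {f : Multiset (Multiset G)}
    (hf : ∀ U ∈ f, IsAtomSeqOn G₀ U) : SeqOn G₀ f.sum := fun g hg => by
  obtain ⟨V, hV, hgV⟩ := Multiset.mem_join.mp hg
  exact (hf V hV).1 g hgV

theorem exists_mem_distancesOf {L : Set ℕ} {s t : ℕ} (hs : s ∈ L) (ht : t ∈ L) (hst : t < s) :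
    ∃ d ∈ distancesOf L, d ≤ s - t := by
  have hex : ∃ d, 0 < d ∧ t + d ∈ L := ⟨s - t, by omega, by rwa [Nat.add_sub_cancel' hst.le]⟩
  obtain ⟨hpos, hmem⟩ := Nat.find_spec hex
  refine ⟨Nat.find hex, ⟨hpos, t, ht, hmem, fun b hb hlt => ?_⟩,
    Nat.find_min' hex ⟨by omega, by rwa [Nat.add_sub_cancel' hst.le]⟩⟩
  exact Nat.find_min hex (m := b - t) (by omega) ⟨by omega, by rwa [Nat.add_sub_cancel' hlt.1.le]⟩

theorem exists_mem_DeltaOn {f f' : Multiset (Multiset G)} (hf : ∀ U ∈ f, IsAtomSeqOn G₀ U)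
    (hf' : ∀ U ∈ f', IsAtomSeqOn G₀ U) (hsum : f.sum = f'.sum)
    (hlt : Multiset.card f < Multiset.card f') :
    ∃ d ∈ DeltaOn G₀, d ≤ Multiset.card f' - Multiset.card f := by
  obtain ⟨d, hd, hle⟩ := exists_mem_distancesOf (L := lengthsOn G₀ f.sum)
    ⟨f', rfl, hf', hsum.symm⟩ ⟨f, rfl, hf, rfl⟩ hlt
  exact ⟨d, ⟨f.sum, IsAtomSeqOn.seqOn_sum hf, IsAtomSeqOn.isProductOne_sum hf, hd⟩, hle⟩

/-- Factorizations of different lengths differ in length by at least `min Δ(G₀)`. -/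
theorem sInf_DeltaOn_le {f f' : Multiset (Multiset G)} (hf : ∀ U ∈ f, IsAtomSeqOn G₀ U)
    (hf' : ∀ U ∈ f', IsAtomSeqOn G₀ U) (hsum : f.sum = f'.sum)
    (hlt : Multiset.card f < Multiset.card f') :
    sInf (DeltaOn G₀) ≤ Multiset.card f' - Multiset.card f := by
  obtain ⟨d, hd, hle⟩ := exists_mem_DeltaOn hf hf' hsum hlt
  exact (Nat.sInf_le hd).trans hle

/-- Splitting off an atom from a product of atoms, one for each of its terms, never decreases
the number of factors. -/
def ExchangeNondecreasing (G₀ : Set G) : Prop :=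
  ∀ (l : List G) (vs : List (Multiset G)) (f : Multiset (Multiset G)),
    IsAtomSeqOn G₀ (l : Multiset G) → l.prod = 1 → (∀ V ∈ vs, IsAtomSeqOn G₀ V) →
    List.Forall₂ (fun g V => g ∈ V) l vs → (∀ V ∈ f, IsAtomSeqOn G₀ V) →
    vs.sum = (l : Multiset G) + f.sum → l.length ≤ Multiset.card f + 1

theorem card_le_card_sum {f : Multiset (Multiset G)} (hf : ∀ V ∈ f, IsAtomSeqOn G₀ V) :
    Multiset.card f ≤ Multiset.card f.sum := by
  simpa using mul_card_le_card_sum (D := 1) fun V hV => Multiset.card_pos.mpr (hf V hV).2.1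

/-- If exchanges never decrease the number of factors, then the lengths of any factorization of a
product of given atoms exceed the number of these atoms by a bounded amount. -/
theorem card_le_add_of_exchangeNondecreasing [Finite G] (H : ExchangeNondecreasing G₀)
    (𝒜 : Finset (Multiset G)) {u f : Multiset (Multiset G)} (h𝒜 : ∀ U ∈ u, U ∈ 𝒜)
    (hu : ∀ U ∈ u, IsAtomSeqOn G₀ U) (hf : ∀ U ∈ f, IsAtomSeqOn G₀ U) (hsum : u.sum = f.sum) :
    Multiset.card f ≤ Multiset.card u + 𝒜.card * (Nat.card G * Nat.card G) * Nat.card G := by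
  induction hn : Multiset.card u generalizing u f with
  | zero =>
    rw [Multiset.card_eq_zero] at hn
    subst hn
    have := card_le_card_sum hf
    rw [← hsum] at this
    simp at this
    simp [this]
  | succ n ih =>
    set D := Nat.card G
    by_cases hbig : ∃ U ∈ u, D * D < u.count U
    · obtain ⟨U, hU, hcount⟩ := hbig
      obtain ⟨l, rfl, hl⟩ := (hu U hU).2.2.1
      have hlD : l.length ≤ D := by simpa using (hu _ hU).2.card_le
      obtain ⟨vs, hle, hvs⟩ := exists_distinct_containing (l := l) (D := D) (f := f)
        (fun V hV => (hf V hV).2.card_le) fun g hg => by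
          have := count_le_count_sum (u := u) (U := (l : Multiset G)) (g := g) (by simpa using hg)
          rw [hsum] at this
          have := Nat.mul_le_mul_left D hlD
          omega
      obtain ⟨f', rfl⟩ := Multiset.le_iff_exists_add.mp hle
      have hvsat : ∀ V ∈ vs, IsAtomSeqOn G₀ V := fun V hV => hf V (by simp [hV])
      obtain ⟨w, hw, hwp⟩ := exists_complement hvs fun V hV => (hvsat V hV).2.2.1
      obtain ⟨h, hh, hhsum⟩ := exists_factorization (G₀ := G₀) (A := (w : Multiset G))
        (fun g hg => by
          have : g ∈ vs.sum := by rw [hw]; simpa using Or.inr hg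
          rw [← Multiset.sum_coe] at this
          exact IsAtomSeqOn.seqOn_sum (G₀ := G₀) (f := (vs : Multiset (Multiset G)))
            (by simpa using hvsat) g this)
        ⟨w, rfl, by rw [hwp, hl, inv_one]⟩
      have hlen := H l vs h (hu _ hU) hl hvsat hvs hh (by rw [hhsum, hw])
      obtain ⟨u', rfl⟩ := Multiset.exists_cons_of_mem hU
      have key := ih (u := u') (f := h + f') (fun V hV => h𝒜 V (by simp [hV]))
        (fun V hV => hu V (by simp [hV]))
        (fun V hV => by
          rcases Multiset.mem_add.mp hV with hV | hV
          exacts [hh V hV, hf V (by simp [hV])])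
        (by
          rw [Multiset.sum_cons, Multiset.sum_add, Multiset.sum_coe, hw, add_assoc] at hsum
          rw [Multiset.sum_add, hhsum]
          exact add_left_cancel hsum)
        (by simpa using hn)
      have hvl := hvs.length_eq
      rw [Multiset.card_add] at key ⊢
      rw [Multiset.coe_card]
      omega
    · push Not at hbig
      have h1 : Multiset.card u ≤ 𝒜.card * (D * D) := by
        rw [← Multiset.toFinset_sum_count_eq]
        calc ∑ a ∈ u.toFinset, u.count a ≤ u.toFinset.card * (D * D) := by
              simpa using Finset.sum_le_card_nsmul u.toFinset (fun a => u.count a) (D * D)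
                fun a ha => hbig a (by simpa using ha)
          _ ≤ 𝒜.card * (D * D) := Nat.mul_le_mul_right _
              (Finset.card_le_card fun a ha => h𝒜 a (by simpa using ha))
      have h2 := card_sum_le (D := D) fun V hV => (hu V hV).2.card_le
      have h3 := card_le_card_sum hf
      have h4 := Nat.mul_le_mul_right D h1
      rw [hsum] at h2
      omega

theorem card_le_of_exchangeNondecreasing [Finite G] (H : ExchangeNondecreasing G₀)
    {u f : Multiset (Multiset G)} (hu : ∀ U ∈ u, IsAtomSeqOn G₀ U)
    (hf : ∀ U ∈ f, IsAtomSeqOn G₀ U) (hsum : u.sum = f.sum) :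
    Multiset.card f ≤ Multiset.card u := by
  set C := u.toFinset.card * (Nat.card G * Nat.card G) * Nat.card G
  have h := card_le_add_of_exchangeNondecreasing H u.toFinset (u := (C + 1) • u)
    (f := (C + 1) • f) (fun U hU => by simpa using Multiset.mem_of_mem_nsmul hU)
    (fun U hU => hu U (Multiset.mem_of_mem_nsmul hU))
    (fun U hU => hf U (Multiset.mem_of_mem_nsmul hU)) (by simp [Multiset.sum_nsmul, hsum])
  rw [Multiset.card_nsmul, Multiset.card_nsmul] at h
  change (C + 1) * _ ≤ (C + 1) * _ + C at h
  by_contra! hlt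
  have := Nat.mul_le_mul_left (C + 1) hlt
  rw [Nat.mul_succ] at this
  omega

theorem not_exchangeNondecreasing [Finite G] (hne : (DeltaOn G₀).Nonempty) :
    ¬ ExchangeNondecreasing G₀ := by
  rintro H
  obtain ⟨d, A, -, -, hpos, a, ⟨f, rfl, hf, rfl⟩, ⟨f', hc, hf', hsum⟩, -⟩ := hne
  have := card_le_of_exchangeNondecreasing H hf hf' hsum.symm
  omega

/-- If `Δ(G₀)` is nonempty, some exchange decreases the number of factors. -/
theorem exists_decreasing_exchange [Finite G] (hne : (DeltaOn G₀).Nonempty) :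
    ∃ (l : List G) (vs : List (Multiset G)) (f : Multiset (Multiset G)),
      IsAtomSeqOn G₀ (l : Multiset G) ∧ l.prod = 1 ∧ (∀ V ∈ vs, IsAtomSeqOn G₀ V) ∧
      List.Forall₂ (fun g V => g ∈ V) l vs ∧ (∀ V ∈ f, IsAtomSeqOn G₀ V) ∧
      vs.sum = (l : Multiset G) + f.sum ∧ 0 < Multiset.card f ∧
      Multiset.card f + sInf (DeltaOn G₀) + 1 ≤ l.length := by
  have h := not_exchangeNondecreasing hne
  simp only [ExchangeNondecreasing] at h
  push Not at h
  obtain ⟨l, vs, f, hl, hl1, hvs, hforall, hf, hsum, hlt⟩ := h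
  have hlen := hforall.length_eq
  refine ⟨l, vs, f, hl, hl1, hvs, hforall, hf, hsum, ?_, ?_⟩
  · rw [Multiset.card_pos]
    rintro rfl
    rw [Multiset.sum_zero, add_zero] at hsum
    match vs, hlen, hvs, hsum with
    | [], hlen, _, _ => simp [hlen] at hlt
    | [V], hlen, _, _ => simp [hlen] at hlt
    | V :: W :: vs, _, hvs, hsum =>
      have hW : (W :: vs).sum ≠ 0 := by
        rw [List.sum_cons]
        exact fun h => (hvs W (by simp)).2.1 (add_eq_zero.mp h).1
      rcases hl.2.2.2 V (W :: vs).sum (by rw [← hsum, List.sum_cons]) (hvs V (by simp)).2.2.1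
        (by
          rw [← Multiset.sum_coe]
          exact isProductOne_sum fun X hX =>
            (hvs X (List.mem_cons_of_mem _ (by simpa using hX))).2.2.1) with h0 | h0
      exacts [(hvs V (by simp)).2.1 h0, hW h0]
  · have := sInf_DeltaOn_le (G₀ := G₀) (f := (l : Multiset G) ::ₘ f)
      (f' := (vs : Multiset (Multiset G)))
      (by
        intro V hV
        rcases Multiset.mem_cons.mp hV with rfl | hV
        exacts [hl, hf V hV])
      (by simpa using hvs) (by simp [hsum]) (by simp; omega)
    simp at this
    omega

theorem le_card_sub_two_of_mem_DeltaStar [Finite G] {d : ℕ} (hd : d ∈ DeltaStar G) :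
    d ≤ Nat.card G - 2 := by
  obtain ⟨G₀, hne, rfl⟩ := hd
  obtain ⟨l, vs, f, hl, -, -, -, -, -, hpos, hle⟩ := exists_decreasing_exchange hne
  have := hl.2.card_le
  rw [Multiset.coe_card] at this
  omega

end Gaps

section Extremal

variable {G : Type*} [Group G] {G₀ : Set G} {A B U V : Multiset G}

theorem isProductOne_add_self {h : Multiset G} (hh : ∀ g ∈ h, g * g = 1) :
    IsProductOne (h + h) := by
  induction h using Multiset.induction with
  | empty => exact isProductOne_zero
  | cons g h ih =>
    have : g ::ₘ h + g ::ₘ h = {g, g} + (h + h) := by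
      simp only [Multiset.insert_eq_cons, Multiset.cons_add, Multiset.add_cons,
        Multiset.singleton_add]
    rw [this]
    exact (isProductOne_pair (hh g (by simp))).add (ih fun x hx => hh x (by simp [hx]))

theorem IsAtomSeq.card_eq_two_of_add_self {h : Multiset G} (hh : ∀ g ∈ h, g * g = 1)
    (hU : IsAtomSeq (h + h)) : Multiset.card (h + h) = 2 := by
  obtain ⟨g, hg⟩ := Multiset.exists_mem_of_ne_zero (s := h) fun h0 => hU.1 (by simp [h0])
  obtain ⟨h', rfl⟩ := Multiset.exists_cons_of_mem hg
  rw [hU.eq_of_le (A := {g, g}) (B := h' + h') (isProductOne_pair (hh g (by simp)))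
    (isProductOne_add_self fun x hx => hh x (by simp [hx])) (by
      simp only [Multiset.insert_eq_cons, Multiset.cons_add, Multiset.add_cons,
        Multiset.singleton_add]) (by simp)]
  simp

theorem exists_add_self_of_even_count {α : Type*} {s : Multiset α} (hs : ∀ a, Even (s.count a)) :
    ∃ h : Multiset α, s = h + h := by
  choose k hk using hs
  induction hn : Multiset.card s using Nat.strong_induction_on generalizing s k with
  | _ n ih =>
    by_cases h0 : s = 0
    · exact ⟨0, by simp [h0]⟩
    obtain ⟨a, ha⟩ := Multiset.exists_mem_of_ne_zero h0
    have h1 := Multiset.count_pos.mpr ha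
    have h2 := hk a
    obtain ⟨t, ht⟩ := Multiset.le_iff_exists_add.mp
      (Multiset.le_count_iff_replicate_le.mp (show 2 ≤ s.count a by omega))
    subst ht
    obtain ⟨h, rfl⟩ := ih (Multiset.card t) (by simp at hn; omega) (s := t)
      (fun b => if b = a then k b - 1 else k b) (fun b => by
        have := hk b
        rw [Multiset.count_add, Multiset.count_replicate] at this
        by_cases hb : a = b
        · subst hb; simp at this ⊢; omega
        · simp [hb] at this; simp [Ne.symm hb, this]) rfl
    exact ⟨a ::ₘ h, by
      simp only [Multiset.replicate_succ, Multiset.replicate_zero, Multiset.cons_add,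
        Multiset.add_cons, zero_add]⟩

/-- A pair of inverse elements of order at least `3` bounds `min Δ(G₀)`. -/
theorem exists_mem_DeltaOn_of_two_lt_orderOf [Finite G] {g : G} (hg : g ∈ G₀) (hg' : g⁻¹ ∈ G₀)
    (h2 : 2 < orderOf g) : ∃ d ∈ DeltaOn G₀, d ≤ orderOf g - 2 := by
  have hg1 : g ≠ 1 := by rintro rfl; simp at h2
  have h := exists_mem_DeltaOn (G₀ := G₀)
    (f := {Multiset.replicate (orderOf g) g, Multiset.replicate (orderOf g⁻¹) g⁻¹})
    (f' := Multiset.replicate (orderOf g) {g, g⁻¹})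
    (by
      intro U hU
      simp only [Multiset.insert_eq_cons, Multiset.mem_cons, Multiset.mem_singleton] at hU
      rcases hU with rfl | rfl
      · exact ⟨fun x hx => Multiset.eq_of_mem_replicate hx ▸ hg, isAtomSeq_replicate_orderOf g⟩
      · exact ⟨fun x hx => Multiset.eq_of_mem_replicate hx ▸ hg', isAtomSeq_replicate_orderOf _⟩)
    (by
      intro U hU
      rw [Multiset.eq_of_mem_replicate hU]
      refine ⟨fun x hx => ?_, isAtomSeq_pair hg1⟩
      simp only [Multiset.insert_eq_cons, Multiset.mem_cons, Multiset.mem_singleton] at hx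
      rcases hx with rfl | rfl <;> assumption)
    (by
      rw [orderOf_inv, Multiset.sum_replicate, Multiset.insert_eq_cons, Multiset.insert_eq_cons,
        Multiset.sum_cons, Multiset.sum_singleton, ← Multiset.singleton_add, nsmul_add,
        Multiset.nsmul_singleton, Multiset.nsmul_singleton])
    (by simpa using h2)
  simpa using h

/-- Over involutions, `min Δ(G₀)` is bounded by the length of a nontrivial atom. -/
theorem exists_mem_DeltaOn_of_two_lt_card (hV : IsAtomSeqOn G₀ V)
    (hinv : ∀ g ∈ V, g ≠ 1 ∧ g * g = 1) (h2 : 2 < Multiset.card V) :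
    ∃ d ∈ DeltaOn G₀, d ≤ Multiset.card V - 2 := by
  have hsum : (V.map fun g => ({g, g} : Multiset G)).sum = V + V := by
    have : (fun g : G => ({g, g} : Multiset G)) = fun g => {g} + {g} := by
      funext g; simp
    rw [this, Multiset.sum_map_add, Multiset.sum_map_singleton]
  have h := exists_mem_DeltaOn (G₀ := G₀) (f := {V, V}) (f' := V.map fun g => {g, g})
    (by simpa using hV)
    (by
      intro U hU
      obtain ⟨g, hg, rfl⟩ := Multiset.mem_map.mp hU
      refine ⟨fun x hx => ?_, ?_⟩
      · simp at hx
        exact hx ▸ hV.1 g hg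
      · have := isAtomSeq_pair (hinv g hg).1
        rwa [← eq_inv_of_mul_eq_one_left (hinv g hg).2] at this)
    (by rw [hsum]; simp) (by simpa using h2)
  simpa using h

/-- Over involutions, a product-one sequence shorter than every nontrivial atom has even
multiplicities. -/
theorem even_count_of_card_lt [Finite G] (hA : IsProductOne A) (hS : SeqOn G₀ A)
    (hinv : ∀ g ∈ A, g ≠ 1 ∧ g * g = 1) (hcard : Multiset.card A < sInf (DeltaOn G₀) + 2) (g : G) :
    Even (A.count g) := by
  obtain ⟨f, hf, rfl⟩ := exists_factorization hS hA
  clear hS hA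
  induction f using Multiset.induction with
  | empty => simp
  | cons V f ih =>
    rw [Multiset.sum_cons] at hinv hcard ⊢
    rw [Multiset.card_add] at hcard
    rw [Multiset.count_add]
    refine Even.add ?_ (ih (fun W hW => hf W (by simp [hW])) (fun x hx => hinv x
      (Multiset.mem_add.mpr (Or.inr hx))) (by omega))
    have hVat := hf V (by simp)
    have hV2 : Multiset.card V ≤ 2 := by
      by_contra! h
      obtain ⟨d, hd, hdle⟩ :=
        exists_mem_DeltaOn_of_two_lt_card hVat (fun x hx => hinv x (by simp [hx])) h
      have := Nat.sInf_le hd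
      omega
    obtain ⟨l, rfl, hl⟩ := hVat.2.2.1
    match l, hl, hV2, hinv, hVat with
    | [], _, _, _, _ => simp
    | [x], hl, _, hinv, _ => exact absurd (by simpa using hl) (hinv x (by simp)).1
    | [x, y], hl, _, hinv, _ =>
      have h1 : x * y = 1 := by simpa using hl
      have h2 := (hinv x (by simp)).2
      have : y = x := mul_left_cancel (h1.trans h2.symm)
      subst this
      rw [Multiset.coe_count, List.count_cons, List.count_cons, List.count_nil]
      split_ifs <;> decide
    | _ :: _ :: _ :: _, _, h, _, _ => simp at h

end Extremal

section Recognition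

variable {G : Type*} [Group G]

/-- A group of order `2 m` consisting of the elements `c ^ k` and `a c ^ k`, where `a` is an
involution inverting `c` and `c ^ m = 1`, is dihedral. -/
theorem nonempty_mulEquiv_dihedralGroup [Finite G] {m : ℕ} {a c : G} (ha : a * a = 1)
    (hac : a * c * a = c⁻¹) (hc : c ^ m = 1) (hcard : Nat.card G = 2 * m)
    (hgen : ∀ x : G, ∃ k : ℤ, x = c ^ k ∨ x = a * c ^ k) :
    Nonempty (G ≃* DihedralGroup m) := by
  have hm : NeZero m := ⟨by rintro rfl; have := Nat.card_pos (α := G); omega⟩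
  let ψ : ZMod m →+ Additive G := ZMod.lift m ⟨zmultiplesHom (Additive G) (Additive.ofMul c), by
    change Additive.ofMul (c ^ (m : ℤ)) = 0
    rw [zpow_natCast, hc]; rfl⟩
  let φ : ZMod m → G := fun i => (ψ i).toMul
  have φ_int : ∀ k : ℤ, φ (k : ZMod m) = c ^ k := fun k => by
    simp only [φ, ψ, ZMod.lift_coe]; rfl
  have φ_add : ∀ i j, φ (i + j) = φ i * φ j := fun i j => by simp [φ]
  have φ_sub : ∀ i j, φ (j - i) = (φ i)⁻¹ * φ j := fun i j => by
    rw [sub_eq_neg_add, φ_add]; simp [φ]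
  have ainv : a⁻¹ = a := inv_eq_of_mul_eq_one_left ha
  have conj : ∀ i, φ i * a = a * (φ i)⁻¹ := fun i => by
    obtain ⟨k, rfl⟩ := ZMod.intCast_surjective i
    have h : a * c * a⁻¹ = c⁻¹ := by rw [ainv, hac]
    have h2 : a * c ^ k * a⁻¹ = (c⁻¹) ^ k := by rw [← conj_zpow, h]
    rw [φ_int, ← inv_zpow, ← h2, ainv, ← mul_assoc, ← mul_assoc, ha, one_mul]
  let F : DihedralGroup m →* G := MonoidHom.mk'
    (fun x => match x with
      | .r i => φ i
      | .sr i => a * φ i) (by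
    rintro (i | i) (j | j)
    · exact φ_add i j
    · change a * φ (j - i) = φ i * (a * φ j)
      rw [φ_sub, ← mul_assoc, ← mul_assoc, conj]
    · change a * φ (i + j) = a * φ i * φ j
      rw [φ_add, mul_assoc]
    · change φ (j - i) = a * φ i * (a * φ j)
      rw [φ_sub, mul_assoc a, ← mul_assoc (φ i), conj, ← mul_assoc, ← mul_assoc, ha, one_mul])
  have hsurj : Function.Surjective F := fun x => by
    obtain ⟨k, rfl | rfl⟩ := hgen x
    · exact ⟨.r k, φ_int k⟩
    · exact ⟨.sr k, by change a * φ k = _; rw [φ_int]⟩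
  have hbij : Function.Bijective F :=
    (Nat.bijective_iff_surjective_and_card F).mpr ⟨hsurj, by rw [DihedralGroup.nat_card, hcard]⟩
  exact ⟨(MulEquiv.ofBijective F hbij).symm⟩

theorem list_prod_eq_zpow_or {a b : G} (ha : a * a = 1) (hb : b * b = 1) {l : List G}
    (hl : ∀ x ∈ l, x = a ∨ x = b) :
    ∃ k : ℤ, l.prod = (a * b) ^ k ∨ l.prod = a * (a * b) ^ k := by
  have hb' : b = a * (a * b) := by rw [← mul_assoc, ha, one_mul]
  have hba : b * a = (a * b)⁻¹ := by
    rw [mul_inv_rev, inv_eq_of_mul_eq_one_left ha, inv_eq_of_mul_eq_one_left hb]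
  induction l with
  | nil => exact ⟨0, by simp⟩
  | cons x l ih =>
    obtain ⟨k, hk⟩ := ih fun y hy => hl y (by simp [hy])
    rw [List.prod_cons]
    rcases hl x (by simp) with rfl | rfl <;> rcases hk with hk | hk
    · exact ⟨k, Or.inr (by rw [hk])⟩
    · exact ⟨k, Or.inl (by rw [hk, ← mul_assoc, ha, one_mul])⟩
    · exact ⟨1 + k, Or.inr (by rw [hk, zpow_one_add, ← mul_assoc a, ← hb'])⟩
    · exact ⟨-1 + k, Or.inl (by rw [hk, ← mul_assoc, hba, zpow_add, zpow_neg_one])⟩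

theorem prod_map_range_alternating (a b : G) (m : ℕ) :
    ((List.range (2 * m)).map fun i => if Even i then a else b).prod = (a * b) ^ m := by
  induction m with
  | zero => simp
  | succ m ih =>
    rw [Nat.mul_succ, List.range_succ, List.range_succ]
    simp [ih, pow_succ]

theorem coe_map_range_alternating {α : Type*} (a b : α) (m : ℕ) :
    (((List.range (2 * m)).map fun i => if Even i then a else b : List α) : Multiset α) =
      Multiset.replicate m a + Multiset.replicate m b := by
  induction m with
  | zero => simp
  | succ m ih =>
    rw [Nat.mul_succ, List.range_succ, List.range_succ]
    simp only [List.map_append, ← Multiset.coe_add, ih, Multiset.replicate_succ]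
    simp [← Multiset.singleton_add]
    abel

theorem list_eq_alternating {α : Type*} {a b : α} {l : List α} (hl : ∀ x ∈ l, x = a ∨ x = b)
    (hne : ∀ (i : ℕ) (h : i + 1 < l.length), l[i] ≠ l[i + 1])
    (h0 : ∀ h : 0 < l.length, l[0] = a) :
    l = (List.range l.length).map fun i => if Even i then a else b := by
  have key : ∀ (i : ℕ) (h : i < l.length), l[i] = if Even i then a else b := by
    intro i
    induction i with
    | zero => intro h; simpa using h0 h
    | succ i ih =>
      intro h
      have h1 := ih (by omega)
      have h2 := hne i h
      have h3 := hl l[i + 1] (List.getElem_mem h)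
      rw [h1] at h2
      by_cases he : Even i
      · simp only [he, if_true] at h2
        simpa [Nat.even_add_one, he] using h3.resolve_left h2.symm
      · simp only [he, if_false] at h2
        simpa [Nat.even_add_one, he] using h3.resolve_right h2.symm
  apply List.ext_getElem (by simp)
  intro i h1 h2
  rw [key i h1]
  simp

end Recognition

section Forward

variable {G : Type*} [Group G] {G₀ : Set G}

theorem IsAtomSeq.getElem_ne_getElem_succ {l : List G} (hU : IsAtomSeq (l : Multiset G))
    (hl : l.prod = 1) (hlen : 3 ≤ l.length) (hinv : ∀ g ∈ l, g * g = 1) (i : ℕ)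
    (h : i + 1 < l.length) : l[i] ≠ l[i + 1] := by
  intro heq
  have hprod : (l.take (i + 2)).prod = (l.take i).prod := by
    rw [List.prod_take_succ _ _ h, List.prod_take_succ _ _ (by omega), ← heq, mul_assoc,
      hinv _ (List.getElem_mem _), mul_one]
  rcases Nat.lt_or_ge (i + 2) l.length with h2 | h2
  · exact hU.take_prod_injOn hl (by omega) h2 hprod.symm
  · rw [List.take_of_length_le h2, hl] at hprod
    exact hU.take_prod_injOn hl (i := 0) (j := i) (by omega) (by omega) (by simpa using hprod)

/-- An extremal atom consisting of involutions has at most two distinct terms: a third term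
would be a chord of the closed walk it describes. -/
theorem eq_getElem_or_of_extremal [Finite G] {l : List G} (hl : IsAtomSeqOn G₀ (l : Multiset G))
    (hl1 : l.prod = 1) (hcard : l.length = Nat.card G) (h3 : 3 ≤ Nat.card G)
    (hinv : ∀ g ∈ l, g ≠ 1 ∧ g * g = 1) (hinf : sInf (DeltaOn G₀) = Nat.card G - 2)
    {c : G} (hc : c ∈ l) : c = l[0] ∨ c = l[l.length - 1] := by
  by_contra! hne
  have hbij : Function.Bijective fun i : Fin l.length => (l.take i).prod :=
    (Nat.bijective_iff_injective_and_card _).mpr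
      ⟨hl.2.take_prod_injective hl1, by simpa using hcard⟩
  obtain ⟨⟨j, hj⟩, hjc⟩ := hbij.2 c
  simp only at hjc
  have hcc := hinv c hc
  have hj0 : j ≠ 0 := by rintro rfl; exact hcc.1 (by simpa using hjc.symm)
  have hj1 : j ≠ 1 := by
    rintro rfl
    rw [List.prod_take_succ l 0 (by omega)] at hjc
    exact hne.1 (by simpa using hjc.symm)
  have hjn : j ≠ l.length - 1 := by
    rintro rfl
    have h := List.prod_take_succ l (l.length - 1) (by omega)
    rw [Nat.sub_add_cancel (by omega), List.take_length, hl1, hjc] at h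
    exact hne.2 (mul_right_cancel ((hinv _ (List.getElem_mem (by omega))).2.trans h)).symm
  have hdrop : (l.drop j).prod = c := by
    have h : (l.take j).prod * (l.drop j).prod = 1 := by
      rw [← List.prod_append, List.take_append_drop, hl1]
    rw [hjc] at h
    exact mul_left_cancel (h.trans hcc.2.symm)
  have heven : ∀ k : List G, k.prod = 1 → (∀ g ∈ k, g ∈ l) → k.length < l.length →
      ∀ g, Even ((k : Multiset G).count g) := fun k hk hkl hlen g =>
    even_count_of_card_lt (G₀ := G₀) ⟨k, rfl, hk⟩ (fun x hx => hl.1 x (hkl x hx))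
      (fun x hx => hinv x (hkl x hx)) (by rw [Multiset.coe_card]; omega) g
  have h1 := heven (c :: l.take j) (by simp [hjc, hcc.2])
    (fun g hg => by
      rcases List.mem_cons.mp hg with rfl | hg
      exacts [hc, List.mem_of_mem_take hg])
    (by simp; omega)
  have h2 := heven (c :: l.drop j) (by simp [hdrop, hcc.2])
    (fun g hg => by
      rcases List.mem_cons.mp hg with rfl | hg
      exacts [hc, List.mem_of_mem_drop hg])
    (by simp; omega)
  obtain ⟨h, hh⟩ := exists_add_self_of_even_count (s := (l : Multiset G)) fun g => by
    have hsplit : (l : Multiset G) = (l.take j : Multiset G) + (l.drop j : Multiset G) := by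
      rw [Multiset.coe_add, List.take_append_drop]
    have := (h1 g).add (h2 g)
    rw [← Multiset.cons_coe, ← Multiset.cons_coe, Multiset.count_cons, Multiset.count_cons] at this
    rw [hsplit, Multiset.count_add]
    grind
  have hat := hl.2
  rw [hh] at hat
  have h2 := hat.card_eq_two_of_add_self fun g hg => (hinv g (by
    rw [← Multiset.mem_coe, hh]; simp [hg])).2
  rw [← hh, Multiset.coe_card] at h2
  omega

theorem dihedral_of_extremal [Finite G] {l : List G} (hl : IsAtomSeqOn G₀ (l : Multiset G))
    (hl1 : l.prod = 1) (hcard : l.length = Nat.card G) (h3 : 3 ≤ Nat.card G)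
    (hinv : ∀ g ∈ l, g ≠ 1 ∧ g * g = 1) (hinf : sInf (DeltaOn G₀) = Nat.card G - 2) :
    ∃ n : ℕ, Odd n ∧ 3 ≤ n ∧ Nonempty (G ≃* DihedralGroup n) := by
  obtain ⟨a, hadef⟩ : ∃ a, a = l[0] := ⟨_, rfl⟩
  obtain ⟨b, hbdef⟩ : ∃ b, b = l[l.length - 1] := ⟨_, rfl⟩
  have hab : ∀ x ∈ l, x = a ∨ x = b := fun x hx => by
    rw [hadef, hbdef]
    exact eq_getElem_or_of_extremal hl hl1 hcard h3 hinv hinf hx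
  have ha : a * a = 1 := (hinv a (hadef ▸ List.getElem_mem _)).2
  have hb : b * b = 1 := (hinv b (hbdef ▸ List.getElem_mem _)).2
  have hne := hl.2.getElem_ne_getElem_succ hl1 (by omega) fun g hg => (hinv g hg).2
  have halt := list_eq_alternating hab hne fun _ => hadef.symm
  have hneab : a ≠ b := by
    rintro rfl
    have := hne 0 (by omega)
    have h0 := hab l[0] (List.getElem_mem _)
    have h1 := hab l[0 + 1] (List.getElem_mem _)
    rw [or_self] at h0 h1
    exact this (h0.trans h1.symm)
  have hodd : ¬ Even (l.length - 1) := fun he => by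
    have : b = a := by
      rw [hbdef]
      conv_lhs => rw [List.getElem_of_eq halt]
      simp [he]
    exact hneab this.symm
  obtain ⟨m, hm⟩ : ∃ m, l.length = 2 * m := by
    obtain ⟨k, hk⟩ := Nat.not_even_iff_odd.mp hodd
    exact ⟨k + 1, by omega⟩
  rw [hm] at halt
  have hpow : (a * b) ^ m = 1 := by rw [← prod_map_range_alternating, ← halt, hl1]
  have hm_odd : Odd m := by
    rw [← Nat.not_even_iff_odd]
    rintro ⟨k, rfl⟩
    have hU : (l : Multiset G) = (Multiset.replicate k a + Multiset.replicate k b) +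
        (Multiset.replicate k a + Multiset.replicate k b) := by
      conv_lhs => rw [halt, coe_map_range_alternating]
      rw [Multiset.replicate_add, Multiset.replicate_add]
      abel
    have hat := hl.2
    rw [hU] at hat
    have h2 := hat.card_eq_two_of_add_self fun g hg => by
      rcases Multiset.mem_add.mp hg with hg | hg <;> rw [Multiset.eq_of_mem_replicate hg] <;>
        assumption
    rw [← hU, Multiset.coe_card] at h2
    omega
  refine ⟨m, hm_odd, ?_, nonempty_mulEquiv_dihedralGroup ha ?_ hpow (by omega) fun x => ?_⟩
  · obtain ⟨k, rfl⟩ := hm_odd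
    omega
  · rw [← mul_assoc, ha, one_mul, mul_inv_rev, inv_eq_of_mul_eq_one_left ha,
      inv_eq_of_mul_eq_one_left hb]
  · obtain ⟨i, rfl⟩ := ((Nat.bijective_iff_injective_and_card _).mpr
      ⟨hl.2.take_prod_injective hl1, by simpa using hcard⟩).2 x
    exact list_prod_eq_zpow_or ha hb fun y hy => hab y (List.mem_of_mem_take hy)

theorem exists_mem_of_forall₂ {α β : Type*} {R : α → β → Prop} {l : List α} {k : List β}
    (h : List.Forall₂ R l k) {a : α} (ha : a ∈ l) : ∃ b ∈ k, R a b := by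
  induction h with
  | nil => simp at ha
  | @cons x y l k hxy _ ih =>
    rcases List.mem_cons.mp ha with rfl | ha
    · exact ⟨y, by simp, hxy⟩
    · obtain ⟨b, hb, hab⟩ := ih ha
      exact ⟨b, by simp [hb], hab⟩

theorem exists_mem_of_forall₂_right {α β : Type*} {R : α → β → Prop} {l : List α} {k : List β}
    (h : List.Forall₂ R l k) {b : β} (hb : b ∈ k) : ∃ a ∈ l, R a b :=
  exists_mem_of_forall₂ h.flip hb

theorem isCyclic_or_dihedral_of_sInf_DeltaOn_eq [Finite G] (h3 : 3 ≤ Nat.card G)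
    (hne : (DeltaOn G₀).Nonempty) (hinf : sInf (DeltaOn G₀) = Nat.card G - 2) :
    IsCyclic G ∨ ∃ n : ℕ, Odd n ∧ 3 ≤ n ∧ Nonempty (G ≃* DihedralGroup n) := by
  by_cases hcyc : IsCyclic G
  · exact Or.inl hcyc
  right
  obtain ⟨l, vs, f, hl, hl1, hvs, hforall, hf, hsum, hpos, hle⟩ := exists_decreasing_exchange hne
  have hlen : l.length ≤ Nat.card G := by simpa using hl.2.card_le
  have hlcard : l.length = Nat.card G := by omega
  have hf1 : Multiset.card f = 1 := by omega
  have hone : ∀ g ∈ l, g ≠ 1 := by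
    rintro g hg rfl
    have := congrArg Multiset.card (hl.2.eq_singleton_one (by simpa using hg))
    rw [Multiset.coe_card, Multiset.card_singleton] at this
    omega
  have hcardvs : ∀ V ∈ vs, 2 ≤ Multiset.card V := fun V hV => by
    obtain ⟨g, hg, hgV⟩ := exists_mem_of_forall₂_right hforall hV
    obtain ⟨s, rfl, hs⟩ := exists_list_prod_eq_inv (hvs V hV).2.2.1 hgV
    cases s with
    | nil => exact absurd (by simpa using hs) (hone g hg)
    | cons x s => simp
  have hinv_mem : ∀ g ∈ l, g⁻¹ ∈ G₀ := fun g hg => by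
    obtain ⟨V, hV, hgV⟩ := exists_mem_of_forall₂ hforall hg
    have hVcard : Multiset.card V ≤ 2 := by
      obtain ⟨k, hk⟩ := Multiset.exists_cons_of_mem (show V ∈ (vs : Multiset _) from hV)
      have h1 := mul_card_le_card_sum (D := 2) (f := k) fun W hW =>
        hcardvs W (by rw [← Multiset.mem_coe, hk]; simp [hW])
      have h2 := congrArg Multiset.card hk
      have h3 := card_sum_le (D := Nat.card G) fun W hW => (hf W hW).2.card_le
      have h4 := congrArg Multiset.card hsum
      have h5 := hforall.length_eq
      rw [← Multiset.sum_coe, hk, Multiset.sum_cons, Multiset.card_add, Multiset.card_add,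
        Multiset.coe_card] at h4
      rw [Multiset.coe_card, Multiset.card_cons] at h2
      rw [hf1] at h3
      omega
    obtain ⟨s, rfl, hs⟩ := exists_list_prod_eq_inv (hvs V hV).2.2.1 hgV
    match s, hs, hVcard with
    | [], hs, _ => exact absurd (by simpa using hs) (hone g hg)
    | [x], hs, _ =>
      have : x = g⁻¹ := by simpa using hs
      exact this ▸ (hvs _ hV).1 x (by simp)
    | _ :: _ :: _, _, h => simp at h
  refine dihedral_of_extremal hl hl1 hlcard h3 (fun g hg => ⟨hone g hg, ?_⟩) hinf
  rcases Nat.lt_or_ge 2 (orderOf g) with h | h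
  · obtain ⟨d, hd, hdle⟩ := exists_mem_DeltaOn_of_two_lt_orderOf (hl.1 g hg) (hinv_mem g hg) h
    have h1 := orderOf_le_card (x := g)
    have h2 := Nat.sInf_le hd
    exact absurd (isCyclic_of_orderOf_eq_card g (by omega)) hcyc
  · have hpos := orderOf_pos g
    have h1 : orderOf g ≠ 1 := fun h => hone g hg (orderOf_eq_one_iff.mp h)
    have h2 : orderOf g = 2 := by omega
    rw [← sq, ← h2, pow_orderOf_eq_one]

end Forward

section Weights

variable {G : Type*} [Group G] {G₀ : Set G} {U : Multiset G}

theorem weight_sum_modEq {w : G → ℕ} {c N : ℕ}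
    (hw : ∀ U, IsAtomSeqOn G₀ U → (U.map w).sum ≡ c [MOD N])
    {f : Multiset (Multiset G)} (hf : ∀ U ∈ f, IsAtomSeqOn G₀ U) :
    (f.sum.map w).sum ≡ c * Multiset.card f [MOD N] := by
  induction f using Multiset.induction with
  | empty => simp; rfl
  | cons V f ih =>
    rw [Multiset.sum_cons, Multiset.map_add, Multiset.sum_add, Multiset.card_cons, Nat.mul_succ,
      add_comm]
    exact (ih fun W hW => hf W (by simp [hW])).add (hw V (hf V (by simp)))

/-- If all atoms have weight `c` modulo `c d`, then all distances are at least `d`. -/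
theorem le_of_mem_DeltaOn_of_weight {w : G → ℕ} {c d : ℕ} (hc : 0 < c)
    (hw : ∀ U, IsAtomSeqOn G₀ U → (U.map w).sum ≡ c [MOD c * d]) {δ : ℕ} (hδ : δ ∈ DeltaOn G₀) :
    d ≤ δ := by
  obtain ⟨A, -, -, hpos, a, ⟨f, rfl, hf, rfl⟩, ⟨f', hcard, hf', hsum⟩, -⟩ := hδ
  have h := (weight_sum_modEq hw hf).symm.trans (hsum ▸ weight_sum_modEq hw hf')
  have h2 := Nat.ModEq.mul_left_cancel' hc.ne' h
  rw [hcard] at h2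
  have h3 := (Nat.modEq_iff_dvd' (by omega)).mp h2
  rw [Nat.add_sub_cancel_left] at h3
  exact Nat.le_of_dvd hpos h3

theorem mem_DeltaStar_of_weight [Finite G] {w : G → ℕ} {c : ℕ} (hc : 0 < c)
    (hw : ∀ U, IsAtomSeqOn G₀ U → (U.map w).sum ≡ c [MOD c * (Nat.card G - 2)])
    (hne : (DeltaOn G₀).Nonempty) : Nat.card G - 2 ∈ DeltaStar G :=
  ⟨G₀, hne, le_antisymm (le_of_mem_DeltaOn_of_weight hc hw (Nat.sInf_mem hne))
    (le_card_sub_two_of_mem_DeltaStar ⟨G₀, hne, rfl⟩)⟩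

theorem IsAtomSeq.eq_replicate_orderOf [Finite G] {x : G} (hU : IsAtomSeq U)
    (hx : ∀ y ∈ U, y = x) : U = Multiset.replicate (orderOf x) x := by
  obtain ⟨k, rfl⟩ : ∃ k, U = Multiset.replicate k x := ⟨_, Multiset.eq_replicate_card.mpr hx⟩
  obtain ⟨l, hl, hp⟩ := hU.2.1
  rw [← Multiset.coe_replicate, Multiset.coe_eq_coe, List.perm_replicate] at hl
  subst hl
  rw [List.prod_replicate, ← orderOf_dvd_iff_pow_eq_one] at hp
  have hk : k ≠ 0 := by rintro rfl; exact hU.1 (by simp)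
  have hle := Nat.le_of_dvd (by omega) hp
  refine hU.eq_of_le (B := Multiset.replicate (k - orderOf x) x)
    (isProductOne_replicate (pow_orderOf_eq_one x))
    (isProductOne_replicate (orderOf_dvd_iff_pow_eq_one.mp (Nat.dvd_sub hp dvd_rfl))) ?_
    (isAtomSeq_replicate_orderOf x).1
  rw [← Multiset.replicate_add, Nat.add_sub_cancel' hle]

end Weights

theorem isProductOne_iff_prod_eq_one {G : Type*} [CommGroup G] {A : Multiset G} :
    IsProductOne A ↔ A.prod = 1 := by
  constructor
  · rintro ⟨l, rfl, hl⟩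
    simpa using hl
  · induction A using Quotient.inductionOn with
    | h l => exact fun h => ⟨l, rfl, by simpa using h⟩

theorem card_sub_two_mem_DeltaStar_of_orderOf_eq {G : Type*} [CommGroup G] [Finite G] {g : G}
    (hg : orderOf g = Nat.card G) (h3 : 3 ≤ Nat.card G) : Nat.card G - 2 ∈ DeltaStar G := by
  have hginv : g⁻¹ ≠ g := fun h => by
    have : g ^ 2 = 1 := by rw [sq, mul_eq_one_iff_inv_eq, h]
    have := Nat.le_of_dvd (by omega) (orderOf_dvd_of_pow_eq_one this)
    omega
  refine mem_DeltaStar_of_weight (G₀ := {g, g⁻¹})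
    (w := fun x => if x = g then 1 else Nat.card G - 1) (c := Nat.card G) (by omega) (fun U hU => ?_) ?_
  · by_cases h1 : g ∈ U
    · by_cases h2 : g⁻¹ ∈ U
      · obtain ⟨T, rfl⟩ := Multiset.exists_cons_of_mem h1
        obtain ⟨S, rfl⟩ := Multiset.exists_cons_of_mem
          ((Multiset.mem_cons.mp h2).resolve_left hginv)
        have hS : IsProductOne S := by
          have := isProductOne_iff_prod_eq_one.mp hU.2.2.1
          rw [isProductOne_iff_prod_eq_one]
          simpa using this
        rw [hU.2.eq_of_le (A := {g, g⁻¹}) (B := S) (isProductOne_pair (by simp)) hS (by simp)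
          (by simp)]
        simp only [Multiset.insert_eq_cons, Multiset.map_cons, Multiset.map_singleton,
          Multiset.sum_cons, Multiset.sum_singleton, if_true, hginv, if_false]
        rw [Nat.add_sub_cancel' (by omega)]
      · rw [hU.2.eq_replicate_orderOf (x := g) fun y hy =>
          (hU.1 y hy).resolve_right fun h => h2 (h ▸ hy), hg]
        simp; rfl
    · rw [hU.2.eq_replicate_orderOf (x := g⁻¹) fun y hy =>
        (hU.1 y hy).resolve_left fun h => h1 (h ▸ hy), orderOf_inv, hg]
      simp only [Multiset.map_replicate, hginv, if_false, Multiset.sum_replicate, smul_eq_mul]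
      have : Nat.card G * (Nat.card G - 1) = Nat.card G + Nat.card G * (Nat.card G - 2) := by
        rw [add_comm, ← Nat.mul_succ]
        congr 1
        omega
      rw [this]
      simp [Nat.ModEq]
  · obtain ⟨d, hd, -⟩ := exists_mem_DeltaOn_of_two_lt_orderOf (G₀ := {g, g⁻¹}) (g := g)
      (by simp) (by simp) (by omega)
    exact ⟨d, hd⟩

section Dihedral

/-- The multiplicity of one of two reflections in a list bounds the rotation part of the
product and determines its parity. -/
theorem exists_int_prod_eq_of_reflections {m : ℕ} {i j : ZMod m} (hij : i ≠ j)
    {l : List (DihedralGroup m)}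
    (hl : ∀ x ∈ l, x = DihedralGroup.sr i ∨ x = DihedralGroup.sr j) :
    ∃ z : ℤ, |z| ≤ l.count (DihedralGroup.sr j) ∧
      (Even z ↔ Even (l.count (DihedralGroup.sr j))) ∧
      ((Even l.length ∧ l.prod = DihedralGroup.r ((z : ZMod m) * (j - i))) ∨
        (¬ Even l.length ∧ l.prod = DihedralGroup.sr (i + (z : ZMod m) * (j - i)))) := by
  induction l with
  | nil => exact ⟨0, by simp, by simp, Or.inl ⟨by simp, by simp⟩⟩
  | cons x l ih =>
    obtain ⟨z, hz, hpar, hprod⟩ := ih fun y hy => hl y (by simp [hy])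
    rw [List.length_cons, List.prod_cons, Nat.even_add_one]
    rcases hl x (by simp) with rfl | rfl
    · rw [List.count_cons_of_ne (by simpa using hij)]
      refine ⟨z, hz, hpar, ?_⟩
      rcases hprod with ⟨he, hp⟩ | ⟨he, hp⟩
      · exact Or.inr ⟨not_not.mpr he, by rw [hp, DihedralGroup.sr_mul_r]⟩
      · exact Or.inl ⟨he, by rw [hp, DihedralGroup.sr_mul_sr, add_sub_cancel_left]⟩
    · rw [List.count_cons_self, Nat.even_add_one, ← hpar]
      rcases hprod with ⟨he, hp⟩ | ⟨he, hp⟩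
      · refine ⟨z + 1, ?_, Int.even_add_one, Or.inr ⟨not_not.mpr he, ?_⟩⟩
        · push_cast
          exact (abs_add_le z 1).trans (by simpa using hz)
        · rw [hp, DihedralGroup.sr_mul_r]
          congr 1
          push_cast
          ring
      · refine ⟨z - 1, ?_, Int.even_sub_one, Or.inl ⟨he, ?_⟩⟩
        · push_cast
          exact (abs_sub z 1).trans (by simpa using hz)
        · rw [hp, DihedralGroup.sr_mul_sr]
          congr 1
          push_cast
          ring

theorem le_count_of_odd_count {m : ℕ} {i j : ZMod m} (hij : i ≠ j) (hu : IsUnit (j - i))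
    {l : List (DihedralGroup m)}
    (hl : ∀ x ∈ l, x = DihedralGroup.sr i ∨ x = DihedralGroup.sr j) (hprod : l.prod = 1) :
    Even l.length ∧
      (Odd (l.count (DihedralGroup.sr j)) → m ≤ l.count (DihedralGroup.sr j)) := by
  obtain ⟨z, hz, hpar, ⟨he, hp⟩ | ⟨he, hp⟩⟩ := exists_int_prod_eq_of_reflections hij hl
  · refine ⟨he, fun hodd => ?_⟩
    rw [hprod, DihedralGroup.one_def, DihedralGroup.r.injEq, eq_comm, hu.mul_left_eq_zero,
      ZMod.intCast_zmod_eq_zero_iff_dvd] at hp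
    have hz0 : z ≠ 0 := by
      rintro rfl
      exact Nat.not_even_iff_odd.mpr hodd (hpar.mp (by simp))
    have := Int.le_of_dvd (abs_pos.mpr hz0) ((dvd_abs _ _).mpr hp)
    exact_mod_cast this.trans hz
  · rw [hprod, DihedralGroup.one_def] at hp
    cases hp

end Dihedral

section Reflections

variable {G : Type*} [Group G] {a b : G} {m : ℕ}

theorem eq_replicate_add_replicate {α : Type*} {a b : α} (hab : a ≠ b) {U : Multiset α}
    (hU : ∀ x ∈ U, x = a ∨ x = b) :
    U = Multiset.replicate (U.count a) a + Multiset.replicate (U.count b) b := by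
  ext x
  rw [Multiset.count_add, Multiset.count_replicate, Multiset.count_replicate]
  by_cases hxa : x = a
  · subst hxa
    simp [hab.symm]
  · by_cases hxb : x = b
    · subst hxb
      simp [hab]
    · rw [Multiset.count_eq_zero_of_notMem fun h => (hU x h).elim hxa hxb]
      simp [Ne.symm hxa, Ne.symm hxb]

/-- Two involutions `a`, `b` such that every product-one sequence over `{a, b}` has even length, and
every odd multiplicity in it is at least `m`. -/
structure IsReflectionPair (a b : G) (m : ℕ) : Prop where
  ne : a ≠ b
  left_ne_one : a ≠ 1
  right_ne_one : b ≠ 1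
  left_mul_self : a * a = 1
  right_mul_self : b * b = 1
  mul_pow : (a * b) ^ m = 1
  even_card : ∀ U : Multiset G, (∀ x ∈ U, x = a ∨ x = b) → IsProductOne U →
    Even (Multiset.card U)
  le_count_left : ∀ U : Multiset G, (∀ x ∈ U, x = a ∨ x = b) → IsProductOne U →
    Odd (U.count a) → m ≤ U.count a
  le_count_right : ∀ U : Multiset G, (∀ x ∈ U, x = a ∨ x = b) → IsProductOne U →
    Odd (U.count b) → m ≤ U.count b

namespace IsReflectionPair

theorem isProductOne_replicate_add (h : IsReflectionPair a b m) :
    IsProductOne (Multiset.replicate m a + Multiset.replicate m b) :=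
  ⟨_, coe_map_range_alternating a b m, by rw [prod_map_range_alternating, h.mul_pow]⟩

theorem card_eq (h : IsReflectionPair a b m) {U : Multiset G} (hU : ∀ x ∈ U, x = a ∨ x = b) :
    Multiset.card U = U.count a + U.count b := by
  conv_lhs => rw [eq_replicate_add_replicate h.ne hU]
  simp

theorem le_counts (h : IsReflectionPair a b m) {U : Multiset G} (hU : ∀ x ∈ U, x = a ∨ x = b)
    (hp : IsProductOne U) (hodd : Odd (U.count a)) :
    m ≤ U.count a ∧ m ≤ U.count b ∧ Odd (U.count b) := by
  have he := h.even_card U hU hp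
  rw [h.card_eq hU] at he
  have hodd' : Odd (U.count b) := by
    rw [Nat.even_add, ← Nat.not_odd_iff_even, ← Nat.not_odd_iff_even] at he
    tauto
  exact ⟨h.le_count_left U hU hp hodd, h.le_count_right U hU hp hodd', hodd'⟩

theorem isAtomSeq (h : IsReflectionPair a b m) (hm : Odd m) :
    IsAtomSeq (Multiset.replicate m a + Multiset.replicate m b) := by
  refine ⟨fun h0 => ?_, h.isProductOne_replicate_add, fun A B hAB hA hB => ?_⟩
  · have := congrArg Multiset.card h0
    simp at this
    have := hm.pos
    omega
  have hmem : ∀ x ∈ A + B, x = a ∨ x = b := by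
    intro x hx
    rw [← hAB, Multiset.mem_add] at hx
    exact hx.imp Multiset.eq_of_mem_replicate Multiset.eq_of_mem_replicate
  have hA' : ∀ x ∈ A, x = a ∨ x = b := fun x hx => hmem x (by simp [hx])
  have hB' : ∀ x ∈ B, x = a ∨ x = b := fun x hx => hmem x (by simp [hx])
  have ha := congrArg (Multiset.count a) hAB
  have hb := congrArg (Multiset.count b) hAB
  simp only [Multiset.count_add, Multiset.count_replicate, if_true, h.ne, h.ne.symm, if_false,
    add_zero, zero_add] at ha hb
  rw [← Multiset.card_eq_zero, ← Multiset.card_eq_zero, h.card_eq hA', h.card_eq hB']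
  have hodd : Odd (A.count a) ∨ Odd (B.count a) := by
    by_contra! hcon
    rw [Nat.not_odd_iff_even, Nat.not_odd_iff_even] at hcon
    exact Nat.not_even_iff_odd.mpr hm (ha ▸ hcon.1.add hcon.2)
  rcases hodd with hodd | hodd
  · have := h.le_counts hA' hA hodd
    omega
  · have := h.le_counts hB' hB hodd
    omega

theorem eq_of_isAtomSeq (h : IsReflectionPair a b m) (hm : Odd m) {U : Multiset G}
    (hU : ∀ x ∈ U, x = a ∨ x = b) (hat : IsAtomSeq U) :
    U = {a, a} ∨ U = {b, b} ∨ U = Multiset.replicate m a + Multiset.replicate m b := by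
  have heven : ∀ {x y : ℕ}, Even x → Even y → ∃ T : Multiset G,
      Multiset.replicate x a + Multiset.replicate y b = T + T ∧ ∀ g ∈ T, g * g = 1 := by
    rintro _ _ ⟨x, rfl⟩ ⟨y, rfl⟩
    refine ⟨Multiset.replicate x a + Multiset.replicate y b, ?_, fun g hg => ?_⟩
    · rw [Multiset.replicate_add, Multiset.replicate_add]
      abel
    · rcases Multiset.mem_add.mp hg with hg | hg <;> rw [Multiset.eq_of_mem_replicate hg]
      exacts [h.left_mul_self, h.right_mul_self]
  have hrep := eq_replicate_add_replicate h.ne hU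
  by_cases hodd : Odd (U.count a)
  · obtain ⟨ha, hb, hodd'⟩ := h.le_counts hU hat.2.1 hodd
    obtain ⟨T, hT, hTT⟩ := heven (Nat.Odd.sub_odd hodd hm) (Nat.Odd.sub_odd hodd' hm)
    refine Or.inr (Or.inr (hat.eq_of_le h.isProductOne_replicate_add
      (hT ▸ isProductOne_add_self hTT) ?_ (h.isAtomSeq hm).1))
    conv_lhs => rw [hrep, ← Nat.add_sub_cancel' ha, ← Nat.add_sub_cancel' hb,
      Multiset.replicate_add, Multiset.replicate_add]
    abel
  · rw [Nat.not_odd_iff_even] at hodd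
    have he := h.even_card U hU hat.2.1
    rw [h.card_eq hU, Nat.even_add, iff_true_left hodd] at he
    obtain ⟨T, hT, hTT⟩ := heven hodd he
    rw [← hrep] at hT
    subst hT
    have h2 := hat.card_eq_two_of_add_self hTT
    obtain ⟨g, rfl⟩ := Multiset.card_eq_one.mp (show Multiset.card T = 1 by
      rw [Multiset.card_add] at h2; omega)
    rcases hU g (by simp) with rfl | rfl
    exacts [Or.inl rfl, Or.inr (Or.inl rfl)]

theorem card_sub_two_mem_DeltaStar [Finite G] (h : IsReflectionPair a b m) (hm : Odd m)
    (h3 : 3 ≤ m) (hcard : Nat.card G = 2 * m) : Nat.card G - 2 ∈ DeltaStar G := by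
  refine mem_DeltaStar_of_weight (G₀ := {a, b}) (w := fun x => if x = a then 1 else 2 * m - 1)
    (c := 2) two_pos (fun U hU => ?_) ?_
  · obtain ⟨k, rfl⟩ := hm
    rw [hcard, show 2 * (2 * k + 1) - 2 = 4 * k by omega,
      show 2 * (2 * k + 1) - 1 = 4 * k + 1 by omega]
    rcases h.eq_of_isAtomSeq ⟨k, rfl⟩ hU.1 hU.2 with rfl | rfl | rfl
    · simp; rfl
    · have : 4 * k + 1 + (4 * k + 1) = 2 + 2 * (4 * k) := by ring
      simp [h.ne.symm, this, Nat.ModEq]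
    · have : 2 * k + 1 + (2 * k + 1) * (4 * k + 1) = 2 + 2 * (4 * k) * (k + 1) := by ring
      simp only [Multiset.map_add, Multiset.map_replicate, Multiset.sum_add,
        Multiset.sum_replicate, if_true, h.ne.symm, if_false, smul_eq_mul, mul_one, this]
      simp [Nat.ModEq]
  · obtain ⟨d, hd, -⟩ := exists_mem_DeltaOn_of_two_lt_card (G₀ := {a, b})
      (V := Multiset.replicate m a + Multiset.replicate m b)
      ⟨fun x hx => (Multiset.mem_add.mp hx).imp Multiset.eq_of_mem_replicate
        Multiset.eq_of_mem_replicate, h.isAtomSeq hm⟩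
      (fun x hx => by
        rcases Multiset.mem_add.mp hx with hx | hx <;> rw [Multiset.eq_of_mem_replicate hx]
        exacts [⟨h.left_ne_one, h.left_mul_self⟩, ⟨h.right_ne_one, h.right_mul_self⟩])
      (by simp; omega)
    exact ⟨d, hd⟩

end IsReflectionPair

theorem isReflectionPair_of_mulEquiv (h3 : 3 ≤ m) (e : G ≃* DihedralGroup m) :
    IsReflectionPair (e.symm (DihedralGroup.sr 0)) (e.symm (DihedralGroup.sr 1)) m := by
  have : Fact (1 < m) := ⟨by omega⟩
  have hlist : ∀ U : Multiset G, (∀ x ∈ U, x = e.symm (DihedralGroup.sr 0) ∨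
      x = e.symm (DihedralGroup.sr 1)) → IsProductOne U → ∃ l : List (DihedralGroup m),
      (∀ x ∈ l, x = DihedralGroup.sr 0 ∨ x = DihedralGroup.sr 1) ∧ l.prod = 1 ∧
      l.length = Multiset.card U ∧ ∀ y, l.count y = U.count (e.symm y) := by
    rintro _ hU ⟨l, rfl, hl⟩
    refine ⟨l.map e, fun x hx => ?_, by rw [← map_list_prod, hl, map_one], by simp, fun y => ?_⟩
    · obtain ⟨g, hg, rfl⟩ := List.mem_map.mp hx
      exact (hU g hg).imp (fun h => by simp [h]) fun h => by simp [h]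
    · conv_lhs => rw [← e.apply_symm_apply y]
      rw [List.count_map_of_injective _ _ e.injective, Multiset.coe_count]
  refine ⟨fun h => ?_, fun h => ?_, fun h => ?_, ?_, ?_, ?_, fun U hU hp => ?_,
    fun U hU hp hodd => ?_, fun U hU hp hodd => ?_⟩
  · simp at h
  · rw [EmbeddingLike.map_eq_one_iff, DihedralGroup.one_def] at h
    cases h
  · rw [EmbeddingLike.map_eq_one_iff, DihedralGroup.one_def] at h
    cases h
  · rw [← map_mul, DihedralGroup.sr_mul_self, map_one]
  · rw [← map_mul, DihedralGroup.sr_mul_self, map_one]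
  · rw [← map_mul, ← map_pow, DihedralGroup.sr_mul_sr, sub_zero, DihedralGroup.r_one_pow_n,
      map_one]
  · obtain ⟨l, hl, hp, hlen, -⟩ := hlist U hU hp
    rw [← hlen]
    exact (le_count_of_odd_count zero_ne_one (by simp) hl hp).1
  · obtain ⟨l, hl, hp, -, hcount⟩ := hlist U hU hp
    rw [← hcount] at hodd ⊢
    exact (le_count_of_odd_count one_ne_zero (by simp) (fun x hx => (hl x hx).symm) hp).2 hodd
  · obtain ⟨l, hl, hp, -, hcount⟩ := hlist U hU hp
    rw [← hcount] at hodd ⊢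
    exact (le_count_of_odd_count zero_ne_one (by simp) hl hp).2 hodd

end Reflections

theorem card_sub_two_mem_DeltaStar_of_isCyclic {G : Type*} [Group G] [Finite G] [IsCyclic G]
    (h3 : 3 ≤ Nat.card G) : Nat.card G - 2 ∈ DeltaStar G := by
  obtain ⟨g, hg⟩ := IsCyclic.exists_ofOrder_eq_natCard (α := G)
  exact @card_sub_two_mem_DeltaStar_of_orderOf_eq G IsCyclic.commGroup _ g hg h3

end ProductOne

open ProductOne in
/-- Let `G` be a finite group with `|G| ≥ 3`. Then
`max Δ*(G) = |G| - 2` iff `G` is cyclic or dihedral of order `2n` for some odd `n ≥ 3`. -/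
theorem max_deltaStar_eq_card_sub_two_iff (G : Type*) [Group G] [Finite G]
    (hG : 3 ≤ Nat.card G) :
    sSup (DeltaStar G) = Nat.card G - 2 ↔
      (IsCyclic G ∨ ∃ n : ℕ, Odd n ∧ 3 ≤ n ∧ Nonempty (G ≃* DihedralGroup n)) := by
  have hbdd : BddAbove (DeltaStar G) := ⟨_, fun _ => le_card_sub_two_of_mem_DeltaStar⟩
  constructor
  · intro h
    have hne : (DeltaStar G).Nonempty := by
      by_contra hempty
      rw [Set.not_nonempty_iff_eq_empty.mp hempty, csSup_empty, bot_eq_zero] at h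
      omega
    obtain ⟨G₀, hG₀, hinf⟩ := h ▸ Nat.sSup_mem hne hbdd
    exact isCyclic_or_dihedral_of_sInf_DeltaOn_eq hG hG₀ hinf.symm
  · intro h
    have hmem : Nat.card G - 2 ∈ DeltaStar G := by
      rcases h with h | ⟨n, hn, h3, ⟨e⟩⟩
      · exact card_sub_two_mem_DeltaStar_of_isCyclic hG
      · exact (isReflectionPair_of_mulEquiv h3 e).card_sub_two_mem_DeltaStar hn h3
          ((Nat.card_congr e.toEquiv).trans DihedralGroup.nat_card)
    exact le_antisymm (csSup_le ⟨_, hmem⟩ fun _ => le_card_sub_two_of_mem_DeltaStar)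
      (le_csSup hbdd hmem)
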